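/- Case 19 of Theorem 1.2 (proved via the highest and second highest root group criterion): the hypergeometric group Γ(f,g) generated by the companion matrices A and B of f(x) = x^5 - x^4 + x - 1 and g(x) = x^5 + 2x^4 + 3x^3 + 3x^2 + 2x + 1 is an arithmetic subgroup of the integral orthogonal group O_Q(ℤ): Γ(f,g) is contained in O_Q(ℤ) (in particular Aᵀ·Q·A = Q and Bᵀ·Q·B = Q), and Γ(f,g) has finite index in O_Q(ℤ). -/

import Mathlib

open Matrix

/-- The companion matrix `A` of `f(x) = x^5 - x^4 + x - 1`. -/
def matA : Matrix (Fin 5) (Fin 5) ℤ :=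
  !![(0 : ℤ), 0, 0, 0, 1; 1, 0, 0, 0, -1; 0, 1, 0, 0, 0; 0, 0, 1, 0, 0; 0, 0, 0, 1, 1]

/-- The companion matrix `B` of `g(x) = x^5 + 2*x^4 + 3*x^3 + 3*x^2 + 2*x + 1`. -/
def matB : Matrix (Fin 5) (Fin 5) ℤ :=
  !![(0 : ℤ), 0, 0, 0, -1; 1, 0, 0, 0, -2; 0, 1, 0, 0, -3; 0, 0, 1, 0, -3; 0, 0, 0, 1, -2]

/-- The symmetric integer matrix `Q` of the quadratic form preserved by `Γ(f,g)`. -/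
def matQ : Matrix (Fin 5) (Fin 5) ℤ :=
  !![(13 : ℤ), -11, 1, 13, -11; -11, 13, -11, 1, 13; 1, -11, 13, -11, 1; 13, 1, -11, 13, -11; -11, 13, 1, -11, 13]

/-- The integral orthogonal group `O_Q(ℤ)` of a matrix `Q`, as the subgroup of `GL₅(ℤ)`
consisting of all `M` with `Mᵀ * Q * M = Q`. -/
def orthogonalSubgroup (Q : Matrix (Fin 5) (Fin 5) ℤ) : Subgroup (GL (Fin 5) ℤ) where
  carrier := { M : GL (Fin 5) ℤ |
      (M : Matrix (Fin 5) (Fin 5) ℤ)ᵀ * Q * (M : Matrix (Fin 5) (Fin 5) ℤ) = Q }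
  one_mem' := by simp
  mul_mem' := by
    intro a b ha hb
    simp only [Set.mem_setOf_eq, Units.val_mul, transpose_mul] at ha hb ⊢
    calc ((b : Matrix (Fin 5) (Fin 5) ℤ)ᵀ * (a : Matrix (Fin 5) (Fin 5) ℤ)ᵀ) * Q *
          ((a : Matrix (Fin 5) (Fin 5) ℤ) * (b : Matrix (Fin 5) (Fin 5) ℤ))
        = (b : Matrix (Fin 5) (Fin 5) ℤ)ᵀ *
            ((a : Matrix (Fin 5) (Fin 5) ℤ)ᵀ * Q * (a : Matrix (Fin 5) (Fin 5) ℤ)) *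
            (b : Matrix (Fin 5) (Fin 5) ℤ) := by
          simp only [mul_assoc]
      _ = Q := by rw [ha, hb]
  inv_mem' := by
    intro a ha
    simp only [Set.mem_setOf_eq] at ha ⊢
    calc ((a⁻¹ : GL (Fin 5) ℤ) : Matrix (Fin 5) (Fin 5) ℤ)ᵀ * Q *
          ((a⁻¹ : GL (Fin 5) ℤ) : Matrix (Fin 5) (Fin 5) ℤ)
        = ((a⁻¹ : GL (Fin 5) ℤ) : Matrix (Fin 5) (Fin 5) ℤ)ᵀ *
            ((a : Matrix (Fin 5) (Fin 5) ℤ)ᵀ * Q * (a : Matrix (Fin 5) (Fin 5) ℤ)) *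
            ((a⁻¹ : GL (Fin 5) ℤ) : Matrix (Fin 5) (Fin 5) ℤ) := by rw [ha]
      _ = ((a : Matrix (Fin 5) (Fin 5) ℤ) *
            ((a⁻¹ : GL (Fin 5) ℤ) : Matrix (Fin 5) (Fin 5) ℤ))ᵀ * Q *
          ((a : Matrix (Fin 5) (Fin 5) ℤ) *
            ((a⁻¹ : GL (Fin 5) ℤ) : Matrix (Fin 5) (Fin 5) ℤ)) := by
          simp only [transpose_mul, mul_assoc]
      _ = Q := by rw [Units.mul_inv]; simp

/-! ### General lemmas on indices -/

theorem relIndex_ne_zero_of_cover {G : Type*} [Group G] (H K : Subgroup G) (T : Set G)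
    (hT : T.Finite) (h : ∀ y ∈ K, ∃ t ∈ T, ∃ x ∈ H, y = x * t) : H.relIndex K ≠ 0 := by
  have h2 : ∀ q : K ⧸ H.subgroupOf K, ∃ t : T, ∃ x ∈ H, ((q.out : K) : G)⁻¹ = x * t := by
    intro q
    obtain ⟨t, ht, x, hx, e⟩ := h _ (K.inv_mem (q.out).2)
    exact ⟨⟨t, ht⟩, x, hx, e⟩
  choose f x hx e using h2
  have : Finite T := hT
  have hinj : Function.Injective f := by
    intro p q hpq
    rw [← QuotientGroup.out_eq' p, ← QuotientGroup.out_eq' q, QuotientGroup.eq]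
    rw [Subgroup.mem_subgroupOf]
    have e1 := e p
    have e2 := e q
    rw [hpq] at e1
    have : (((Quotient.out p)⁻¹ * Quotient.out q : K) : G) = x p * (x q)⁻¹ := by
      have e3 : ((q.out : K) : G) = (x q * (f q : G))⁻¹ := by rw [← e2, inv_inv]
      push_cast
      rw [e1, e3]
      group
    rw [this]
    exact H.mul_mem (hx p) (H.inv_mem (hx q))
  have : Finite (K ⧸ H.subgroupOf K) := Finite.of_injective f hinj
  exact Subgroup.index_ne_zero_of_finite

theorem relIndex_ne_zero_of_step {G : Type*} [Group G] (S S' : Set G) (γ : G) (k : ℕ) (hk : 0 < k)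
    (hconj : ∀ s ∈ S, γ * s * γ⁻¹ ∈ Subgroup.closure S) (hpow : γ ^ k ∈ Subgroup.closure S)
    (hS' : ∀ s ∈ S', s ∈ S ∨ s = γ ∨ s = γ⁻¹) :
    (Subgroup.closure S).relIndex (Subgroup.closure S') ≠ 0 := by
  set H := Subgroup.closure S with hH
  have hc : ∀ h ∈ H, γ * h * γ⁻¹ ∈ H := by
    intro h hh
    have : H ≤ H.comap (MulAut.conj γ).toMonoidHom := by
      rw [hH, Subgroup.closure_le]
      intro s hs
      simpa using hconj s hs
    simpa using this hh
  let P : G → Prop := fun y => ∃ h ∈ H, ∃ n : ℕ, y = h * γ ^ n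
  have P1 : ∀ h ∈ H, ∀ y, P y → P (h * y) := by
    rintro h hh y ⟨h', hh', n, rfl⟩
    exact ⟨h * h', H.mul_mem hh hh', n, by group⟩
  have P2 : ∀ y, P y → P (γ * y) := by
    rintro y ⟨h', hh', n, rfl⟩
    exact ⟨γ * h' * γ⁻¹, hc _ hh', n + 1, by rw [pow_succ']; group⟩
  have P2n : ∀ (n : ℕ) y, P y → P (γ ^ n * y) := by
    intro n
    induction n with
    | zero => intro y hy; simpa using hy
    | succ n ih => intro y hy; rw [pow_succ', mul_assoc]; exact P2 _ (ih _ hy)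
  have P3 : ∀ y, P y → P (γ⁻¹ * y) := by
    intro y hy
    have : γ⁻¹ * y = γ ^ (k - 1) * ((γ ^ k)⁻¹ * y) := by
      obtain ⟨m, rfl⟩ : ∃ m, k = m + 1 := ⟨k - 1, by omega⟩
      rw [Nat.add_sub_cancel, pow_succ']
      group
    rw [this]
    exact P2n _ _ (P1 _ (H.inv_mem hpow) _ hy)
  have hP : ∀ y ∈ Subgroup.closure S', P y := by
    intro y hy
    induction hy using Subgroup.closure_induction_left with
    | one => exact ⟨1, H.one_mem, 0, by simp⟩
    | mul_left s hs y _ ih =>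
      rcases hS' s hs with h | rfl | rfl
      · exact P1 _ (Subgroup.subset_closure h) _ ih
      · exact P2 _ ih
      · exact P3 _ ih
    | inv_mul_cancel s hs y _ ih =>
      rcases hS' s hs with h | rfl | rfl
      · exact P1 _ (H.inv_mem (Subgroup.subset_closure h)) _ ih
      · exact P3 _ ih
      · rw [inv_inv]; exact P2 _ ih
  refine relIndex_ne_zero_of_cover H _ ((fun n => γ ^ n) '' (Set.Iio k))
    ((Set.finite_Iio k).image _) ?_
  intro y hy
  obtain ⟨h, hh, n, rfl⟩ := hP y hy
  refine ⟨_, ⟨n % k, Nat.mod_lt _ hk, rfl⟩, h * (γ ^ k) ^ (n / k),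
    H.mul_mem hh (H.pow_mem hpow _), ?_⟩
  show _ = _ * γ ^ (n % k)
  rw [mul_assoc, ← pow_mul, ← pow_add, Nat.div_add_mod]

theorem zfamily_mem {G : Type*} [Group G] (L : Subgroup G) (F : ℤ → G)
    (hF : ∀ a b, F (a + b) = F a * F b) (h1 : F 1 ∈ L) (k : ℤ) : F k ∈ L := by
  induction k using Int.induction_on with
  | zero =>
    have : F 0 = 1 := by simpa using hF 0 0
    rw [this]; exact L.one_mem
  | succ i ih => rw [hF]; exact L.mul_mem ih h1
  | pred i ih =>
    have : F (-(i : ℤ) - 1) = F (-(i : ℤ)) * (F 1)⁻¹ := by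
      rw [eq_mul_inv_iff_mul_eq, ← hF]; congr 1; ring
    rw [this]; exact L.mul_mem ih (L.inv_mem h1)

/-! ### Concrete 5 × 5 integer matrices -/

/-- A row of integers. -/
structure V5 where
  (a b c d e : ℤ)

/-- A concrete 5 × 5 matrix, given by its rows. -/
structure M5 where
  (r0 r1 r2 r3 r4 : V5)

namespace V5

/-- Linear combination of the rows of a matrix. -/
def lin (v : V5) (m : M5) : V5 :=
  ⟨v.a * m.r0.a + v.b * m.r1.a + v.c * m.r2.a + v.d * m.r3.a + v.e * m.r4.a,
   v.a * m.r0.b + v.b * m.r1.b + v.c * m.r2.b + v.d * m.r3.b + v.e * m.r4.b,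
   v.a * m.r0.c + v.b * m.r1.c + v.c * m.r2.c + v.d * m.r3.c + v.e * m.r4.c,
   v.a * m.r0.d + v.b * m.r1.d + v.c * m.r2.d + v.d * m.r3.d + v.e * m.r4.d,
   v.a * m.r0.e + v.b * m.r1.e + v.c * m.r2.e + v.d * m.r3.e + v.e * m.r4.e⟩

end V5

/-- Evaluate a natural number before continuing. -/
def forceN {α : Type} (n : ℕ) (k : ℕ → α) : α :=
  match n with
  | 0 => k 0
  | m + 1 => k (m + 1)

theorem forceN_eq {α : Type} (n : ℕ) (k : ℕ → α) : forceN n k = k n := by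
  cases n <;> rfl

/-- Evaluate an integer before continuing. -/
def forceI {α : Type} (x : ℤ) (k : ℤ → α) : α :=
  match x with
  | Int.ofNat n => forceN n fun m => k (Int.ofNat m)
  | Int.negSucc n => forceN n fun m => k (Int.negSucc m)

theorem forceI_eq {α : Type} (x : ℤ) (k : ℤ → α) : forceI x k = k x := by
  cases x <;> simp [forceI, forceN_eq]

/-- Evaluate a row before continuing. -/
def forceV {α : Type} (v : V5) (k : V5 → α) : α :=
  forceI v.a fun a => forceI v.b fun b => forceI v.c fun c => forceI v.d fun d =>
    forceI v.e fun e => k ⟨a, b, c, d, e⟩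

theorem forceV_eq {α : Type} (v : V5) (k : V5 → α) : forceV v k = k v := by
  simp [forceV, forceI_eq]

namespace M5

/-- Matrix product. -/
def mul (x y : M5) : M5 := ⟨x.r0.lin y, x.r1.lin y, x.r2.lin y, x.r3.lin y, x.r4.lin y⟩

/-- Matrix product with forced evaluation. -/
def mulF (x y : M5) : M5 :=
  forceV (x.r0.lin y) fun a => forceV (x.r1.lin y) fun b => forceV (x.r2.lin y) fun c =>
    forceV (x.r3.lin y) fun d => forceV (x.r4.lin y) fun e => ⟨a, b, c, d, e⟩

theorem mulF_eq (x y : M5) : mulF x y = mul x y := by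
  simp [mulF, mul, forceV_eq]

/-- The identity. -/
def one : M5 :=
  ⟨⟨1, 0, 0, 0, 0⟩, ⟨0, 1, 0, 0, 0⟩, ⟨0, 0, 1, 0, 0⟩, ⟨0, 0, 0, 1, 0⟩, ⟨0, 0, 0, 0, 1⟩⟩

/-- The associated matrix. -/
def toM (m : M5) : Matrix (Fin 5) (Fin 5) ℤ :=
  !![m.r0.a, m.r0.b, m.r0.c, m.r0.d, m.r0.e;
     m.r1.a, m.r1.b, m.r1.c, m.r1.d, m.r1.e;
     m.r2.a, m.r2.b, m.r2.c, m.r2.d, m.r2.e;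
     m.r3.a, m.r3.b, m.r3.c, m.r3.d, m.r3.e;
     m.r4.a, m.r4.b, m.r4.c, m.r4.d, m.r4.e]

theorem toM_mul (x y : M5) : (mul x y).toM = x.toM * y.toM := by
  ext i j
  fin_cases i <;> fin_cases j <;>
    simp [toM, mul, V5.lin, Matrix.mul_apply, Fin.sum_univ_succ] <;> ring

theorem toM_one : one.toM = 1 := by
  ext i j
  fin_cases i <;> fin_cases j <;> rfl

/-- Boolean equality of rows. -/
def beqV (v w : V5) : Bool :=
  decide (v.a = w.a) && decide (v.b = w.b) && decide (v.c = w.c) && decide (v.d = w.d) &&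
    decide (v.e = w.e)

theorem eq_of_beqV {v w : V5} (h : beqV v w = true) : v = w := by
  cases v; cases w
  simp only [beqV, Bool.and_eq_true, decide_eq_true_eq] at h
  simp [h]

/-- Boolean equality of matrices. -/
def beq (x y : M5) : Bool :=
  beqV x.r0 y.r0 && beqV x.r1 y.r1 && beqV x.r2 y.r2 && beqV x.r3 y.r3 && beqV x.r4 y.r4

theorem eq_of_beq {x y : M5} (h : beq x y = true) : x = y := by
  cases x; cases y
  simp only [beq, Bool.and_eq_true] at h
  obtain ⟨⟨⟨⟨h0, h1⟩, h2⟩, h3⟩, h4⟩ := h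
  simp [eq_of_beqV h0, eq_of_beqV h1, eq_of_beqV h2, eq_of_beqV h3, eq_of_beqV h4]

/-- An invertible matrix from a concrete matrix and its inverse. -/
def gl (x y : M5) (h : mul x y = one) (h' : mul y x = one) : GL (Fin 5) ℤ :=
  ⟨x.toM, y.toM, by rw [← toM_mul, h, toM_one], by rw [← toM_mul, h', toM_one]⟩

end M5

/-- Table of the matrices used in the certificates: the reflections R0..R7 (0-7), t2z (8, 9),
t1z (10, 11), tf1z (12, 13), sz (14), A (15, 16), tt (17, 18), t12 (19, 20), s1 (21), s2 (22),
m1 (23), d2 (24), B (25, 26), t1f2 (27, 28). -/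
def ltr : Fin 29 → M5 := ![
  ⟨⟨3, 2, -12, 0, -2⟩, ⟨0, 1, 0, 0, 0⟩, ⟨1, 1, -5, 0, -1⟩, ⟨-1, -1, 6, 1, 1⟩, ⟨-2, -2, 12, 0, 3⟩⟩,
  ⟨⟨3, 0, -12, 2, -2⟩, ⟨-1, 1, 6, -1, 1⟩, ⟨1, 0, -5, 1, -1⟩, ⟨0, 0, 0, 1, 0⟩, ⟨-2, 0, 12, -2, 3⟩⟩,
  ⟨⟨1, -2, -12, 4, -2⟩, ⟨0, 3, 12, -4, 2⟩, ⟨0, -1, -5, 2, -1⟩, ⟨0, -1, -6, 3, -1⟩, ⟨0, 0, 0, 0, 1⟩⟩,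
  ⟨⟨1, 0, 0, 0, 0⟩, ⟨1, 3, 6, -1, 0⟩, ⟨-1, -2, -5, 1, 0⟩, ⟨-2, -4, -12, 3, 0⟩, ⟨-2, -4, -12, 2, 1⟩⟩,
  ⟨⟨3, 2, 12, 0, -2⟩, ⟨0, 1, 0, 0, 0⟩, ⟨-1, -1, -5, 0, 1⟩, ⟨-1, -1, -6, 1, 1⟩, ⟨-2, -2, -12, 0, 3⟩⟩,
  ⟨⟨3, 0, 12, 2, -2⟩, ⟨-1, 1, -6, -1, 1⟩, ⟨-1, 0, -5, -1, 1⟩, ⟨0, 0, 0, 1, 0⟩, ⟨-2, 0, -12, -2, 3⟩⟩,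
  ⟨⟨1, -2, 12, 4, -2⟩, ⟨0, 3, -12, -4, 2⟩, ⟨0, 1, -5, -2, 1⟩, ⟨0, -1, 6, 3, -1⟩, ⟨0, 0, 0, 0, 1⟩⟩,
  ⟨⟨1, 0, 0, 0, 0⟩, ⟨1, 3, -6, -1, 0⟩, ⟨1, 2, -5, -1, 0⟩, ⟨-2, -4, 12, 3, 0⟩, ⟨-2, -4, 12, 2, 1⟩⟩,
  ⟨⟨1, 0, 0, 0, 0⟩, ⟨0, 1, -6, -3, 0⟩, ⟨0, 0, 1, 1, 0⟩, ⟨0, 0, 0, 1, 0⟩, ⟨0, 0, 0, 0, 1⟩⟩,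
  ⟨⟨1, 0, 0, 0, 0⟩, ⟨0, 1, 6, -3, 0⟩, ⟨0, 0, 1, -1, 0⟩, ⟨0, 0, 0, 1, 0⟩, ⟨0, 0, 0, 0, 1⟩⟩,
  ⟨⟨1, 0, -12, 0, -6⟩, ⟨0, 1, 0, 0, 0⟩, ⟨0, 0, 1, 0, 1⟩, ⟨0, 0, 0, 1, 0⟩, ⟨0, 0, 0, 0, 1⟩⟩,
  ⟨⟨1, 0, 12, 0, -6⟩, ⟨0, 1, 0, 0, 0⟩, ⟨0, 0, 1, 0, -1⟩, ⟨0, 0, 0, 1, 0⟩, ⟨0, 0, 0, 0, 1⟩⟩,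
  ⟨⟨1, 0, 0, 0, 0⟩, ⟨0, 1, 0, 0, 0⟩, ⟨1, 0, 1, 0, 0⟩, ⟨0, 0, 0, 1, 0⟩, ⟨-6, 0, -12, 0, 1⟩⟩,
  ⟨⟨1, 0, 0, 0, 0⟩, ⟨0, 1, 0, 0, 0⟩, ⟨-1, 0, 1, 0, 0⟩, ⟨0, 0, 0, 1, 0⟩, ⟨-6, 0, 12, 0, 1⟩⟩,
  ⟨⟨1, 0, 0, 0, 0⟩, ⟨0, 1, 0, 0, 0⟩, ⟨0, 0, -1, 0, 0⟩, ⟨0, 0, 0, 1, 0⟩, ⟨0, 0, 0, 0, 1⟩⟩,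
  ⟨⟨0, 0, 0, 0, -1⟩, ⟨0, 0, 0, -1, 1⟩, ⟨0, 0, 1, 0, 0⟩, ⟨0, -1, 0, 0, 0⟩, ⟨-1, -2, 0, 0, 0⟩⟩,
  ⟨⟨0, 0, 0, 2, -1⟩, ⟨0, 0, 0, -1, 0⟩, ⟨0, 0, 1, 0, 0⟩, ⟨-1, -1, 0, 0, 0⟩, ⟨-1, 0, 0, 0, 0⟩⟩,
  ⟨⟨-1, 0, 0, -2, 0⟩, ⟨0, -1, 0, 0, 1⟩, ⟨0, 0, 1, 0, 0⟩, ⟨1, 0, 0, 1, 0⟩, ⟨0, -2, 0, 0, 1⟩⟩,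
  ⟨⟨1, 0, 0, 2, 0⟩, ⟨0, 1, 0, 0, -1⟩, ⟨0, 0, 1, 0, 0⟩, ⟨-1, 0, 0, -1, 0⟩, ⟨0, 2, 0, 0, -1⟩⟩,
  ⟨⟨1, 0, 0, -2, 0⟩, ⟨0, 1, 0, 0, 1⟩, ⟨0, 0, 1, 0, 0⟩, ⟨0, 0, 0, 1, 0⟩, ⟨0, 0, 0, 0, 1⟩⟩,
  ⟨⟨1, 0, 0, 2, 0⟩, ⟨0, 1, 0, 0, -1⟩, ⟨0, 0, 1, 0, 0⟩, ⟨0, 0, 0, 1, 0⟩, ⟨0, 0, 0, 0, 1⟩⟩,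
  ⟨⟨0, 0, 0, 0, 1⟩, ⟨0, 1, 0, 0, 0⟩, ⟨0, 0, 1, 0, 0⟩, ⟨0, 0, 0, 1, 0⟩, ⟨1, 0, 0, 0, 0⟩⟩,
  ⟨⟨1, 0, 0, 0, 0⟩, ⟨0, 0, 0, 1, 0⟩, ⟨0, 0, 1, 0, 0⟩, ⟨0, 1, 0, 0, 0⟩, ⟨0, 0, 0, 0, 1⟩⟩,
  ⟨⟨-1, 0, 0, 0, 0⟩, ⟨0, -1, 0, 0, 0⟩, ⟨0, 0, -1, 0, 0⟩, ⟨0, 0, 0, -1, 0⟩, ⟨0, 0, 0, 0, -1⟩⟩,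
  ⟨⟨1, 0, 0, 0, 0⟩, ⟨0, -1, 0, 0, 0⟩, ⟨0, 0, 1, 0, 0⟩, ⟨0, 0, 0, -1, 0⟩, ⟨0, 0, 0, 0, 1⟩⟩,
  ⟨⟨2, 2, -12, 0, -3⟩, ⟨-1, -1, 6, -1, 2⟩, ⟨1, 1, -5, 0, -1⟩, ⟨0, -1, 0, 0, 0⟩, ⟨-3, -4, 12, 0, 2⟩⟩,
  ⟨⟨2, 0, -12, 4, -3⟩, ⟨0, 0, 0, -1, 0⟩, ⟨1, 0, -5, 1, -1⟩, ⟨-2, -1, 6, -1, 1⟩, ⟨-3, 0, 12, -2, 2⟩⟩,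
  ⟨⟨1, -2, 0, 0, 0⟩, ⟨0, 1, 0, 0, 0⟩, ⟨0, 0, 1, 0, 0⟩, ⟨0, 0, 0, 1, 1⟩, ⟨0, 0, 0, 0, 1⟩⟩,
  ⟨⟨1, 2, 0, 0, 0⟩, ⟨0, 1, 0, 0, 0⟩, ⟨0, 0, 1, 0, 0⟩, ⟨0, 0, 0, 1, -1⟩, ⟨0, 0, 0, 0, 1⟩⟩]

/-- Index of the inverse letter. -/
def linv : Fin 29 → Fin 29 := ![0, 1, 2, 3, 4, 5, 6, 7, 9, 8, 11, 10, 13, 12, 14, 16, 15, 18, 17, 20, 19, 21, 22, 23, 24, 26, 25, 28, 27]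

/-- Words for the conjugates of the earlier letters by the letter `t2z`. -/
def cert1 : List (List (Fin 29)) := [
  [0, 2, 3, 4, 3, 2, 0],
  [4, 5, 6, 7, 1, 2, 3, 4, 5, 4, 3, 2, 1, 7, 6, 5, 4],
  [4, 5, 6, 7, 1, 2, 3, 4, 5, 4, 3, 4, 5, 6, 7, 1, 2, 3, 4, 5, 4, 3, 2, 0, 7, 6, 7, 0, 2],
  [4, 5, 6, 1, 2, 3, 4, 6, 7, 6, 4, 3, 2, 1, 6, 5, 4],
  [2, 1, 0, 7, 5, 3, 2, 1, 2, 3, 5, 6, 7, 1, 2, 3, 4, 5, 4, 3, 2, 0, 7, 6, 7, 0, 2],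
  [2, 1, 0, 7, 5, 4, 3, 2, 1, 2, 3, 4, 5, 7, 0, 1, 2],
  [2, 0, 7, 6, 7, 0, 2],
  [3]]

/-- Word for the power of the letter `t2z`. -/
def pcert1 : List (Fin 29) := [4, 5, 6, 7, 1, 2, 3, 4, 6, 7, 0, 1, 3, 4, 5, 6]

/-- Words for the conjugates of the earlier letters by the letter `t1z`. -/
def cert2 : List (List (Fin 29)) := [
  [4],
  [5],
  [5, 4, 3, 9, 2, 7, 0, 1, 7, 0, 1, 3, 4, 5, 9],
  [5, 4, 3, 7, 0, 1, 0, 1, 5, 4, 3],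
  [3, 4, 5, 1, 0, 7, 0, 1, 0, 7, 3, 4, 5],
  [3, 4, 5, 1, 0, 7, 0, 7, 3, 4, 5],
  [8, 4, 3, 8, 6, 5, 8, 5, 4, 3, 5, 4, 3, 9, 2, 8, 4, 3, 8, 6, 5],
  [3],
  [5, 4, 3, 9, 2, 8, 4, 3, 8, 6, 5],
  [5, 6, 9, 3, 4, 9, 2, 8, 3, 4, 5]]

/-- Word for the power of the letter `t1z`. -/
def pcert2 : List (Fin 29) := [3, 4, 5, 1, 0, 7]

/-- Words for the conjugates of the earlier letters by the letter `tf1z`. -/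
def cert3 : List (List (Fin 29)) := [
  [2, 1, 0, 8, 5, 10, 0, 9, 2, 9, 1, 0, 1, 11, 8, 10, 8, 5, 9, 4, 5, 6, 9, 5, 6, 9, 4, 5, 10],
  [2, 1, 0, 1, 11, 6, 9, 1, 8, 6, 5, 4, 5, 10, 2],
  [2, 1, 0, 4, 5, 4, 5, 6, 2, 1, 0],
  [0, 1, 2, 9, 6, 5, 4, 6, 5, 4, 2, 1, 0, 5, 4, 3, 4, 5, 9],
  [0],
  [1],
  [2],
  [2, 1, 0, 9, 1, 9, 11, 6, 9, 4, 5, 9, 5, 9, 5, 6, 7, 9, 5, 10, 2],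
  [9, 1, 9, 1, 9, 9, 11, 9, 10],
  [11, 8, 10, 8, 8, 1, 8, 1, 8],
  [1, 0, 9, 1, 9, 11, 6, 9, 4, 5, 8, 0, 9, 2, 1, 0, 8, 1, 8, 1, 8, 8, 11, 8, 10],
  [11, 9, 10, 9, 9, 1, 9, 1, 9, 0, 1, 2, 8, 0, 9, 5, 4, 8, 6, 10, 8, 1, 8, 0, 1]]

/-- Word for the power of the letter `tf1z`. -/
def pcert3 : List (Fin 29) := [0, 1, 2, 6, 5, 4]

/-- Words for the conjugates of the earlier letters by the letter `sz`. -/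
def cert4 : List (List (Fin 29)) := [
  [4],
  [5],
  [6],
  [7],
  [0],
  [1],
  [2],
  [3],
  [9],
  [8],
  [11],
  [10],
  [13],
  [12]]

/-- Word for the power of the letter `sz`. -/
def pcert4 : List (Fin 29) := []

/-- Words for the conjugates of the earlier letters by the letter `A`. -/
def cert5 : List (List (Fin 29)) := [
  [1],
  [2],
  [3],
  [4],
  [5],
  [6],
  [7],
  [0],
  [5, 6, 9, 2, 1],
  [1, 2, 8, 6, 5],
  [13],
  [12],
  [8, 11, 8],
  [9, 10, 9],
  [14]]

/-- Word for the power of the letter `A`. -/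
def pcert5 : List (Fin 29) := []

/-- Words for the conjugates of the earlier letters by the letter `tt`. -/
def cert6 : List (List (Fin 29)) := [
  [1, 0, 7, 0, 1],
  [4, 5, 6, 5, 4],
  [3, 2, 1, 2, 3],
  [4, 8, 0, 9, 4],
  [5, 4, 3, 4, 5],
  [0, 1, 2, 1, 0],
  [7, 6, 5, 6, 7],
  [0, 8, 0, 9, 0],
  [13, 15, 9, 2, 8, 11, 6, 9, 16],
  [15, 8, 6, 10, 9, 2, 8, 16, 12],
  [16, 9, 12, 9, 15],
  [16, 8, 13, 8, 15],
  [8, 12, 8],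
  [9, 13, 9],
  [14],
  [16, 16, 9, 13, 10, 0, 7, 15, 8, 0, 3],
  [3, 0, 9, 16, 7, 0, 11, 12, 8, 15, 15]]

/-- Word for the power of the letter `tt`. -/
def pcert6 : List (Fin 29) := [15, 15, 15, 15]

/-- Words for the coset representatives. -/
def reps : Fin 18 → List (Fin 29) := ![
  [], [27], [27, 27], [19], [19, 27], [19, 27, 27], [19, 19], [19, 19, 27], [19, 19, 27, 27], [22], [27, 22], [27, 27, 22], [19, 22], [19, 27, 22], [19, 27, 27, 22], [19, 19, 22], [19, 19, 27, 22], [19, 19, 27, 27, 22]]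

/-- Letters generating the big group. -/
def big : Fin 11 → Fin 29 := ![19, 20, 10, 11, 8, 9, 21, 22, 14, 23, 24]

/-- Coset table: `reps a * big g = word * reps c`. -/
def ctab : Fin 18 → Fin 11 → Fin 18 × List (Fin 29) := ![
  ![(3, []), (6, [16, 16, 8, 15, 13, 15, 9]), (0, [10]), (0, [11]), (0, [8]), (0, [9]), (10, [15, 17, 17]), (9, []), (0, [14]), (0, [14, 17, 17]), (17, [2, 17, 1, 18, 2])],
  ![(4, []), (7, [16, 16, 8, 15, 13, 15, 9]), (1, [10]), (1, [11]), (1, [15, 15, 9, 16, 16]), (1, [15, 15, 8, 16, 16]), (9, [15, 15, 15]), (10, []), (1, [14]), (1, [14, 17, 17]), (14, [2, 17, 1, 18, 2])],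
  ![(5, []), (8, [16, 16, 8, 15, 13, 15, 9]), (2, [10]), (2, [11]), (2, [11, 8, 11]), (2, [10, 9, 10]), (11, [16, 9, 1, 0, 11, 16, 18, 9, 15]), (11, []), (2, [14]), (2, [14, 17, 17]), (11, [2, 17, 1, 18, 2])],
  ![(6, []), (0, []), (3, [10]), (3, [11]), (3, [8]), (3, [9]), (16, [18, 16, 8, 15, 13, 15, 9]), (12, []), (3, [14]), (3, [14, 17, 17]), (16, [2, 17, 1, 18, 2])],
  ![(7, []), (1, []), (4, [10]), (4, [11]), (4, [15, 15, 9, 16, 16]), (4, [15, 15, 8, 16, 16]), (15, [18, 12, 15, 8, 16, 16, 9]), (13, []), (4, [14]), (4, [14, 17, 17]), (13, [2, 17, 1, 18, 2])],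
  ![(8, []), (2, []), (5, [10]), (5, [11]), (5, [11, 8, 11]), (5, [10, 9, 10]), (17, [17, 16, 6, 9, 7, 16, 17, 9, 15]), (14, []), (5, [14]), (5, [14, 17, 17]), (10, [2, 17, 1, 18, 2])],
  ![(0, [18, 18, 1, 0, 7, 8, 6, 9, 11]), (3, []), (6, [10]), (6, [11]), (6, [8]), (6, [9]), (13, [8, 0, 11, 15, 17, 9, 4]), (15, []), (6, [14]), (6, [14, 17, 17]), (15, [2, 17, 1, 18, 2])],
  ![(1, [18, 18, 1, 0, 7, 8, 6, 9, 11]), (4, []), (7, [10]), (7, [11]), (7, [15, 15, 9, 16, 16]), (7, [15, 15, 8, 16, 16]), (12, [8, 1, 17, 0, 12, 15, 8]), (16, []), (7, [14]), (7, [14, 17, 17]), (12, [2, 17, 1, 18, 2])],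
  ![(2, [18, 18, 1, 0, 7, 8, 6, 9, 11]), (5, []), (8, [10]), (8, [11]), (8, [11, 8, 11]), (8, [10, 9, 10]), (14, [16, 9, 17, 0, 15, 8, 6, 15, 17]), (17, []), (8, [14]), (8, [14, 17, 17]), (9, [2, 17, 1, 18, 2])],
  ![(10, []), (11, [16, 8, 12, 17, 8, 18, 15]), (9, [10]), (9, [11]), (9, [16, 9, 15]), (9, [16, 8, 15]), (1, [15, 17, 17]), (0, []), (9, [14]), (9, [14, 17, 17]), (8, [2, 17, 1, 18, 2])],
  ![(11, []), (9, []), (10, [10]), (10, [11]), (10, [16, 9, 15]), (10, [16, 8, 15]), (0, [15, 15, 15]), (1, []), (10, [14]), (10, [14, 17, 17]), (5, [2, 17, 1, 18, 2])],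
  ![(9, [16, 8, 17, 8, 18, 12, 15]), (10, []), (11, [10]), (11, [11]), (11, [16, 9, 15]), (11, [16, 8, 15]), (2, [16, 9, 1, 0, 11, 16, 18, 9, 15]), (2, []), (11, [14]), (11, [14, 17, 17]), (2, [2, 17, 1, 18, 2])],
  ![(13, []), (14, [16, 8, 12, 17, 8, 18, 15]), (12, [10]), (12, [11]), (12, [17, 16, 9, 15, 18]), (12, [17, 16, 8, 15, 18]), (7, [18, 16, 8, 15, 13, 15, 9]), (3, []), (12, [14]), (12, [14, 17, 17]), (7, [2, 17, 1, 18, 2])],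
  ![(14, []), (12, []), (13, [10]), (13, [11]), (13, [17, 16, 9, 15, 18]), (13, [17, 16, 8, 15, 18]), (6, [18, 12, 15, 8, 16, 16, 9]), (4, []), (13, [14]), (13, [14, 17, 17]), (4, [2, 17, 1, 18, 2])],
  ![(12, [16, 8, 17, 8, 18, 12, 15]), (13, []), (14, [10]), (14, [11]), (14, [17, 16, 9, 15, 18]), (14, [17, 16, 8, 15, 18]), (8, [17, 16, 6, 9, 7, 16, 17, 9, 15]), (5, []), (14, [14]), (14, [14, 17, 17]), (1, [2, 17, 1, 18, 2])],
  ![(16, []), (17, [16, 8, 12, 17, 8, 18, 15]), (15, [10]), (15, [11]), (15, [11, 16, 9, 12, 15]), (15, [10, 16, 8, 13, 15]), (4, [8, 0, 11, 15, 17, 9, 4]), (6, []), (15, [14]), (15, [14, 17, 17]), (6, [2, 17, 1, 18, 2])],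
  ![(17, []), (15, []), (16, [10]), (16, [11]), (16, [11, 16, 9, 12, 15]), (16, [10, 16, 8, 13, 15]), (3, [8, 1, 17, 0, 12, 15, 8]), (7, []), (16, [14]), (16, [14, 17, 17]), (3, [2, 17, 1, 18, 2])],
  ![(15, [16, 8, 17, 8, 18, 12, 15]), (16, []), (17, [10]), (17, [11]), (17, [11, 16, 9, 12, 15]), (17, [10, 16, 8, 13, 15]), (5, [16, 9, 17, 0, 15, 8, 6, 15, 17]), (8, []), (17, [14]), (17, [14, 17, 17]), (0, [2, 17, 1, 18, 2])]]

theorem ltr_inv (i : Fin 29) : M5.beq (M5.mulF (ltr i) (ltr (linv i))) M5.one = true := by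
  revert i; decide +kernel

theorem linv_linv (i : Fin 29) : linv (linv i) = i := by
  revert i; decide +kernel

theorem ltr_mul_inv (i : Fin 29) : M5.mul (ltr i) (ltr (linv i)) = M5.one := by
  have := M5.eq_of_beq (ltr_inv i)
  rwa [M5.mulF_eq] at this

/-- The letters as elements of `GL₅(ℤ)`. -/
def gl (i : Fin 29) : GL (Fin 5) ℤ :=
  M5.gl (ltr i) (ltr (linv i)) (ltr_mul_inv i)
    (by have := ltr_mul_inv (linv i); rwa [linv_linv] at this)

theorem gl_val (i : Fin 29) : (gl i : Matrix (Fin 5) (Fin 5) ℤ) = (ltr i).toM := rfl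

theorem gl_linv (i : Fin 29) : gl (linv i) = (gl i)⁻¹ := by
  ext1
  rfl

/-- Evaluation of words as concrete matrices. -/
def ev : List (Fin 29) → M5
  | [] => M5.one
  | i :: w => M5.mulF (ltr i) (ev w)

/-- Evaluation of words in the group. -/
def evG (w : List (Fin 29)) : GL (Fin 5) ℤ := (w.map gl).prod

theorem evG_val (w : List (Fin 29)) : (evG w : Matrix (Fin 5) (Fin 5) ℤ) = (ev w).toM := by
  induction w with
  | nil => simp [evG, ev, M5.toM_one]
  | cons i w ih =>
    rw [ev, M5.mulF_eq, M5.toM_mul, ← ih, ← gl_val]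
    simp [evG]

/-- Boolean check that two words agree. -/
def weq (u v : List (Fin 29)) : Bool := M5.beq (ev u) (ev v)

theorem evG_eq {u v : List (Fin 29)} (h : weq u v = true) : evG u = evG v := by
  ext1
  rw [evG_val, evG_val, M5.eq_of_beq h]

theorem evG_append (u v : List (Fin 29)) : evG (u ++ v) = evG u * evG v := by
  simp [evG]

theorem evG_mem {H : Subgroup (GL (Fin 5) ℤ)} {w : List (Fin 29)} (h : ∀ i ∈ w, gl i ∈ H) :
    evG w ∈ H := by
  apply H.list_prod_mem
  simpa using h

/-- The first `n` letters. -/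
def gset (n : ℕ) : Set (GL (Fin 5) ℤ) := {x | ∃ i : Fin 29, i.val < n ∧ gl i = x}

theorem evG_mem_gset {n : ℕ} {w : List (Fin 29)} (h : (w.all fun i => decide (i.val < n)) = true) :
    evG w ∈ Subgroup.closure (gset n) := by
  apply evG_mem
  intro i hi
  apply Subgroup.subset_closure
  exact ⟨i, by simpa using List.all_eq_true.mp h i hi, rfl⟩

/-- Check of one step of the chain. -/
def stepCheck (n : ℕ) (g : Fin 29) (k : ℕ) (c : List (List (Fin 29))) (p : List (Fin 29)) : Bool :=
  ((List.finRange 29).all fun i => !decide (i.val < n) ||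
    (weq [g, i, linv g] (c.getD i.val []) && (c.getD i.val []).all fun j => decide (j.val < n))) &&
  (weq (List.replicate k g) p && p.all fun j => decide (j.val < n))

theorem chain_step (n n' : ℕ) (g : Fin 29) (k : ℕ) (hk : 0 < k) (c : List (List (Fin 29)))
    (p : List (Fin 29)) (hc : stepCheck n g k c p = true)
    (hn : ∀ i : Fin 29, i.val < n' → i.val < n ∨ i = g ∨ i = linv g) :
    (Subgroup.closure (gset n)).relIndex (Subgroup.closure (gset n')) ≠ 0 := by
  simp only [stepCheck, Bool.and_eq_true] at hc
  obtain ⟨hc1, hc2, hc3⟩ := hc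
  refine relIndex_ne_zero_of_step _ _ (gl g) k hk ?_ ?_ ?_
  · rintro s ⟨i, hi, rfl⟩
    have h1 := List.all_eq_true.mp hc1 i (List.mem_finRange i)
    simp only [hi, decide_true, Bool.not_true, Bool.false_or, Bool.and_eq_true] at h1
    have h2 := evG_eq h1.1
    have h3 : evG [g, i, linv g] = gl g * gl i * (gl g)⁻¹ := by
      simp [evG, gl_linv, mul_assoc]
    rw [← h3, h2]
    exact evG_mem_gset h1.2
  · have h2 := evG_eq hc2
    have h3 : evG (List.replicate k g) = gl g ^ k := by simp [evG]
    rw [← h3, h2]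
    exact evG_mem_gset hc3
  · rintro s ⟨i, hi, rfl⟩
    rcases hn i hi with h | rfl | rfl
    · exact Or.inl ⟨i, h, rfl⟩
    · exact Or.inr (Or.inl rfl)
    · exact Or.inr (Or.inr (gl_linv _))

theorem chain1 : (Subgroup.closure (gset 8)).relIndex (Subgroup.closure (gset 10)) ≠ 0 :=
  chain_step 8 10 8 2 (by norm_num) cert1 pcert1 (by decide +kernel) (by decide +kernel)

theorem chain2 : (Subgroup.closure (gset 10)).relIndex (Subgroup.closure (gset 12)) ≠ 0 :=
  chain_step 10 12 10 2 (by norm_num) cert2 pcert2 (by decide +kernel) (by decide +kernel)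

theorem chain3 : (Subgroup.closure (gset 12)).relIndex (Subgroup.closure (gset 14)) ≠ 0 :=
  chain_step 12 14 12 2 (by norm_num) cert3 pcert3 (by decide +kernel) (by decide +kernel)

theorem chain4 : (Subgroup.closure (gset 14)).relIndex (Subgroup.closure (gset 15)) ≠ 0 :=
  chain_step 14 15 14 2 (by norm_num) cert4 pcert4 (by decide +kernel) (by decide +kernel)

theorem chain5 : (Subgroup.closure (gset 15)).relIndex (Subgroup.closure (gset 17)) ≠ 0 :=
  chain_step 15 17 15 8 (by norm_num) cert5 pcert5 (by decide +kernel) (by decide +kernel)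

theorem chain6 : (Subgroup.closure (gset 17)).relIndex (Subgroup.closure (gset 19)) ≠ 0 :=
  chain_step 17 19 17 2 (by norm_num) cert6 pcert6 (by decide +kernel) (by decide +kernel)

/-- The big group. -/
def bigG : Subgroup (GL (Fin 5) ℤ) := Subgroup.closure (Set.range fun i => gl (big i))

theorem ctab_check : ((List.finRange 18).all fun a => (List.finRange 11).all fun g =>
    weq (reps a ++ [big g]) ((ctab a g).2 ++ reps (ctab a g).1) &&
      (ctab a g).2.all fun j => decide (j.val < 19)) = true := by
  decide +kernel

theorem big_inv (i : Fin 11) : ∃ j, linv (big i) = big j := by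
  revert i; decide +kernel

theorem chain7 : (Subgroup.closure (gset 19)).relIndex bigG ≠ 0 := by
  refine relIndex_ne_zero_of_cover _ _ (Set.range fun a => evG (reps a)) (Set.finite_range _) ?_
  have key : ∀ (a : Fin 18) (g : Fin 11), ∃ c, ∃ x ∈ Subgroup.closure (gset 19),
      evG (reps a) * gl (big g) = x * evG (reps c) := by
    intro a g
    have h1 := List.all_eq_true.mp (List.all_eq_true.mp ctab_check a (List.mem_finRange a)) g
      (List.mem_finRange g)
    rw [Bool.and_eq_true] at h1
    refine ⟨(ctab a g).1, evG (ctab a g).2, evG_mem_gset h1.2, ?_⟩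
    have h2 := evG_eq h1.1
    rw [evG_append, evG_append] at h2
    rw [← h2]
    simp [evG]
  intro y hy
  have : ∃ c, ∃ x ∈ Subgroup.closure (gset 19), y = x * evG (reps c) := by
    have step : ∀ (y : GL (Fin 5) ℤ) (g : Fin 11),
        (∃ c, ∃ x ∈ Subgroup.closure (gset 19), y = x * evG (reps c)) →
        (∃ c, ∃ x ∈ Subgroup.closure (gset 19), y * gl (big g) = x * evG (reps c)) := by
      rintro y g ⟨c, x, hx, rfl⟩
      obtain ⟨d, x', hx', e⟩ := key c g
      exact ⟨d, x * x', Subgroup.mul_mem _ hx hx', by rw [mul_assoc, e, mul_assoc]⟩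
    induction hy using Subgroup.closure_induction_right with
    | one => exact ⟨0, 1, Subgroup.one_mem _, by simp [evG, reps]⟩
    | mul_right y _ s hs ih =>
      obtain ⟨g, rfl⟩ := hs
      exact step y g ih
    | mul_inv_cancel y _ s hs ih =>
      obtain ⟨g, rfl⟩ := hs
      obtain ⟨j, hj⟩ := big_inv g
      show ∃ c, ∃ x ∈ Subgroup.closure (gset 19), y * (gl (big g))⁻¹ = x * evG (reps c)
      rw [← gl_linv, hj]
      exact step y j ih
  obtain ⟨c, x, hx, e⟩ := this
  exact ⟨_, ⟨c, rfl⟩, x, hx, e⟩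

theorem chain_total : (Subgroup.closure (gset 8)).relIndex bigG ≠ 0 :=
  Subgroup.relIndex_ne_zero_trans (Subgroup.relIndex_ne_zero_trans
    (Subgroup.relIndex_ne_zero_trans (Subgroup.relIndex_ne_zero_trans
      (Subgroup.relIndex_ne_zero_trans (Subgroup.relIndex_ne_zero_trans
        chain1 chain2) chain3) chain4) chain5) chain6) chain7

/-- The group generated by `A` and `B` in the new basis contains the reflections. -/
theorem gset8_le (H : Subgroup (GL (Fin 5) ℤ)) (hA : gl 15 ∈ H) (hB : gl 25 ∈ H) :
    Subgroup.closure (gset 8) ≤ H := by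
  have hA' : gl 16 ∈ H := by
    have : gl 16 = (gl 15)⁻¹ := gl_linv 15
    rw [this]; exact H.inv_mem hA
  have hw : ∀ i : Fin 29, i.val < 8 → weq [i]
      (List.replicate i.val 15 ++ ([16, 25] ++ List.replicate i.val 16)) = true := by
    decide +kernel
  rw [Subgroup.closure_le]
  rintro s ⟨i, hi, rfl⟩
  have h1 := evG_eq (hw i hi)
  have h2 : evG [i] = gl i := by simp [evG]
  rw [← h2, h1]
  apply evG_mem
  intro j hj
  simp only [List.mem_append, List.mem_replicate, List.mem_cons, List.not_mem_nil, or_false] at hj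
  rcases hj with ⟨_, rfl⟩ | (rfl | rfl) | ⟨_, rfl⟩ <;> assumption

/-! ### The orthogonal group of the split form and its generation -/

/-- The Gram matrix in the new basis. -/
def matG : Matrix (Fin 5) (Fin 5) ℤ :=
  !![0, 0, 0, 0, 1; 0, 0, 0, 2, 0; 0, 0, 12, 0, 0; 0, 2, 0, 0, 0; 1, 0, 0, 0, 0]

/-- The bilinear form. -/
def bf (u v : Fin 5 → ℤ) : ℤ :=
  u 0 * v 4 + 2 * u 1 * v 3 + 12 * u 2 * v 2 + 2 * u 3 * v 1 + u 4 * v 0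

theorem bf_eq (u v : Fin 5 → ℤ) : bf u v = u ⬝ᵥ (matG *ᵥ v) := by
  simp [bf, matG, dotProduct, mulVec, Fin.sum_univ_succ]
  ring

/-- Action on vectors. -/
def act (g : GL (Fin 5) ℤ) (v : Fin 5 → ℤ) : Fin 5 → ℤ := (g : Matrix (Fin 5) (Fin 5) ℤ) *ᵥ v

theorem act_mul (g h : GL (Fin 5) ℤ) (v : Fin 5 → ℤ) : act (g * h) v = act g (act h v) := by
  simp [act, mulVec_mulVec]

theorem act_one (v : Fin 5 → ℤ) : act 1 v = v := by simp [act]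

theorem bf_act {g : GL (Fin 5) ℤ} (hg : g ∈ orthogonalSubgroup matG) (u v : Fin 5 → ℤ) :
    bf (act g u) (act g v) = bf u v := by
  have h : (g : Matrix (Fin 5) (Fin 5) ℤ)ᵀ * matG * (g : Matrix (Fin 5) (Fin 5) ℤ) = matG := hg
  rw [bf_eq, bf_eq, act, act]
  conv_rhs => rw [← h]
  rw [← mulVec_mulVec, ← mulVec_mulVec, dotProduct_mulVec u, vecMul_transpose]

theorem bigG_le : bigG ≤ orthogonalSubgroup matG := by
  rw [bigG, Subgroup.closure_le]
  rintro s ⟨i, rfl⟩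
  have h : ∀ i : Fin 11, (ltr (big i)).toMᵀ * matG * (ltr (big i)).toM = matG := by
    decide +kernel
  exact h i

theorem gl_big (i : Fin 11) : gl (big i) ∈ bigG := Subgroup.subset_closure ⟨i, rfl⟩

/-- Concrete form of a family. -/
def m12 (k : ℤ) : M5 :=
  ⟨⟨1, 0, 0, -2 * k, 0⟩, ⟨0, 1, 0, 0, k⟩, ⟨0, 0, 1, 0, 0⟩, ⟨0, 0, 0, 1, 0⟩, ⟨0, 0, 0, 0, 1⟩⟩

/-- Concrete form of a family. -/
def m1z (k : ℤ) : M5 :=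
  ⟨⟨1, 0, -12 * k, 0, -6 * k ^ 2⟩, ⟨0, 1, 0, 0, 0⟩, ⟨0, 0, 1, 0, k⟩, ⟨0, 0, 0, 1, 0⟩,
    ⟨0, 0, 0, 0, 1⟩⟩

/-- Concrete form of a family. -/
def m2z (k : ℤ) : M5 :=
  ⟨⟨1, 0, 0, 0, 0⟩, ⟨0, 1, -6 * k, -3 * k ^ 2, 0⟩, ⟨0, 0, 1, k, 0⟩, ⟨0, 0, 0, 1, 0⟩,
    ⟨0, 0, 0, 0, 1⟩⟩

theorem m12_mul (a b : ℤ) : M5.mul (m12 a) (m12 b) = m12 (a + b) := by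
  simp [M5.mul, m12, V5.lin]; constructor <;> ring

theorem m1z_mul (a b : ℤ) : M5.mul (m1z a) (m1z b) = m1z (a + b) := by
  simp [M5.mul, m1z, V5.lin]; refine ⟨⟨?_, ?_⟩, ?_⟩ <;> ring

theorem m2z_mul (a b : ℤ) : M5.mul (m2z a) (m2z b) = m2z (a + b) := by
  simp [M5.mul, m2z, V5.lin]; refine ⟨⟨?_, ?_⟩, ?_⟩ <;> ring

theorem fam_mem (m : ℤ → M5) (hm : ∀ a b, M5.mul (m a) (m b) = m (a + b)) (h0 : m 0 = M5.one)
    (i : Fin 11) (hi : (m 1).toM = (ltr (big i)).toM) (k : ℤ) :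
    ∃ g ∈ bigG, (g : Matrix (Fin 5) (Fin 5) ℤ) = (m k).toM := by
  let F : ℤ → GL (Fin 5) ℤ := fun k => M5.gl (m k) (m (-k)) (by rw [hm, add_neg_cancel, h0])
    (by rw [hm, neg_add_cancel, h0])
  refine ⟨F k, zfamily_mem bigG F ?_ ?_ k, rfl⟩
  · intro a b
    ext1
    show (m (a + b)).toM = (m a).toM * (m b).toM
    rw [← hm, M5.toM_mul]
  · have : F 1 = gl (big i) := by
      ext1
      exact hi
    rw [this]
    exact gl_big i

/-- `w` can be reached from `v` by an element of the big group fixing `S` pointwise. -/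
def Reach (S : Set (Fin 5 → ℤ)) (v w : Fin 5 → ℤ) : Prop :=
  ∃ g ∈ bigG, (∀ u ∈ S, act g u = u) ∧ act g v = w

theorem Reach.trans {S : Set (Fin 5 → ℤ)} {u v w : Fin 5 → ℤ} (h : Reach S u v)
    (h' : Reach S v w) : Reach S u w := by
  obtain ⟨g, hg, hs, rfl⟩ := h
  obtain ⟨g', hg', hs', rfl⟩ := h'
  refine ⟨g' * g, bigG.mul_mem hg' hg, ?_, act_mul _ _ _⟩
  intro u hu
  rw [act_mul, hs u hu, hs' u hu]

theorem Reach.refl (S : Set (Fin 5 → ℤ)) (v : Fin 5 → ℤ) : Reach S v v :=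
  ⟨1, bigG.one_mem, fun u _ => act_one u, act_one v⟩

theorem toM_mulVec (m : M5) (a b c d e : ℤ) : m.toM *ᵥ ![a, b, c, d, e] =
    ![m.r0.a * a + m.r0.b * b + m.r0.c * c + m.r0.d * d + m.r0.e * e,
      m.r1.a * a + m.r1.b * b + m.r1.c * c + m.r1.d * d + m.r1.e * e,
      m.r2.a * a + m.r2.b * b + m.r2.c * c + m.r2.d * d + m.r2.e * e,
      m.r3.a * a + m.r3.b * b + m.r3.c * c + m.r3.d * d + m.r3.e * e,
      m.r4.a * a + m.r4.b * b + m.r4.c * c + m.r4.d * d + m.r4.e * e] := by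
  ext i
  fin_cases i <;> simp [M5.toM, mulVec, dotProduct, Fin.sum_univ_succ] <;> ring

theorem reach_of_mat {S : Set (Fin 5 → ℤ)} {m : M5}
    (hm : ∃ g ∈ bigG, (g : Matrix (Fin 5) (Fin 5) ℤ) = m.toM)
    (hS : ∀ u ∈ S, m.toM *ᵥ u = u) (v : Fin 5 → ℤ) : Reach S v (m.toM *ᵥ v) := by
  obtain ⟨g, hg, e⟩ := hm
  refine ⟨g, hg, ?_, ?_⟩
  · intro u hu
    rw [act, e, hS u hu]
  · rw [act, e]

theorem hm12 (k : ℤ) : ∃ g ∈ bigG, (g : Matrix (Fin 5) (Fin 5) ℤ) = (m12 k).toM :=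
  fam_mem m12 m12_mul rfl 0 (by decide +kernel) k

theorem hm1z (k : ℤ) : ∃ g ∈ bigG, (g : Matrix (Fin 5) (Fin 5) ℤ) = (m1z k).toM :=
  fam_mem m1z m1z_mul rfl 2 (by decide +kernel) k

theorem hm2z (k : ℤ) : ∃ g ∈ bigG, (g : Matrix (Fin 5) (Fin 5) ℤ) = (m2z k).toM :=
  fam_mem m2z m2z_mul rfl 4 (by decide +kernel) k

theorem hgl (i : Fin 11) : ∃ g ∈ bigG, (g : Matrix (Fin 5) (Fin 5) ℤ) = (ltr (big i)).toM :=
  ⟨gl (big i), gl_big i, rfl⟩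

/-- Swap of the outer coordinates. -/
def ms1 : M5 :=
  ⟨⟨0, 0, 0, 0, 1⟩, ⟨0, 1, 0, 0, 0⟩, ⟨0, 0, 1, 0, 0⟩, ⟨0, 0, 0, 1, 0⟩, ⟨1, 0, 0, 0, 0⟩⟩

/-- Swap of the inner coordinates. -/
def ms2 : M5 :=
  ⟨⟨1, 0, 0, 0, 0⟩, ⟨0, 0, 0, 1, 0⟩, ⟨0, 0, 1, 0, 0⟩, ⟨0, 1, 0, 0, 0⟩, ⟨0, 0, 0, 0, 1⟩⟩

/-- Diagonal matrices. -/
def mdiag (a b c d e : ℤ) : M5 :=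
  ⟨⟨a, 0, 0, 0, 0⟩, ⟨0, b, 0, 0, 0⟩, ⟨0, 0, c, 0, 0⟩, ⟨0, 0, 0, d, 0⟩, ⟨0, 0, 0, 0, e⟩⟩

theorem hms1 : ∃ g ∈ bigG, (g : Matrix (Fin 5) (Fin 5) ℤ) = ms1.toM := hgl 6

theorem hms2 : ∃ g ∈ bigG, (g : Matrix (Fin 5) (Fin 5) ℤ) = ms2.toM := hgl 7

theorem hsz : ∃ g ∈ bigG, (g : Matrix (Fin 5) (Fin 5) ℤ) = (mdiag 1 1 (-1) 1 1).toM := hgl 8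

theorem hneg : ∃ g ∈ bigG,
    (g : Matrix (Fin 5) (Fin 5) ℤ) = (mdiag (-1) (-1) (-1) (-1) (-1)).toM := hgl 9

theorem hd2 : ∃ g ∈ bigG, (g : Matrix (Fin 5) (Fin 5) ℤ) = (mdiag 1 (-1) 1 (-1) 1).toM := hgl 10

section rules

variable (a b c d e k : ℤ)

theorem r_t12 : Reach ∅ ![a, b, c, d, e] ![a - 2 * k * d, b + k * e, c, d, e] := by
  have h := reach_of_mat (S := ∅) (hm12 k) (by simp) ![a, b, c, d, e]
  rw [toM_mulVec] at h
  convert h using 2 <;> simp [m12] <;> ring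

theorem r_t1z : Reach ∅ ![a, b, c, d, e]
    ![a - 12 * k * c - 6 * k ^ 2 * e, b, c + k * e, d, e] := by
  have h := reach_of_mat (S := ∅) (hm1z k) (by simp) ![a, b, c, d, e]
  rw [toM_mulVec] at h
  convert h using 2 <;> simp [m1z] <;> ring

theorem r_t2z (S : Set (Fin 5 → ℤ)) (hS : ∀ k, ∀ u ∈ S, (m2z k).toM *ᵥ u = u) :
    Reach S ![a, b, c, d, e] ![a, b - 6 * k * c - 3 * k ^ 2 * d, c + k * d, d, e] := by
  have h := reach_of_mat (S := S) (hm2z k) (hS k) ![a, b, c, d, e]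
  rw [toM_mulVec] at h
  convert h using 2 <;> simp [m2z] <;> ring

theorem r_s1 : Reach ∅ ![a, b, c, d, e] ![e, b, c, d, a] := by
  have h := reach_of_mat (S := ∅) hms1 (by simp) ![a, b, c, d, e]
  rw [toM_mulVec] at h
  simpa [ms1] using h

theorem r_s2 (S : Set (Fin 5 → ℤ)) (hS : ∀ u ∈ S, ms2.toM *ᵥ u = u) :
    Reach S ![a, b, c, d, e] ![a, d, c, b, e] := by
  have h := reach_of_mat (S := S) hms2 hS ![a, b, c, d, e]
  rw [toM_mulVec] at h
  simpa [ms2] using h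

theorem r_neg : Reach ∅ ![a, b, c, d, e] ![-a, -b, -c, -d, -e] := by
  have h := reach_of_mat (S := ∅) hneg (by simp) ![a, b, c, d, e]
  rw [toM_mulVec] at h
  simpa [mdiag] using h

theorem r_d2 (S : Set (Fin 5 → ℤ)) (hS : ∀ u ∈ S, (mdiag 1 (-1) 1 (-1) 1).toM *ᵥ u = u) :
    Reach S ![a, b, c, d, e] ![a, -b, c, -d, e] := by
  have h := reach_of_mat (S := S) hd2 hS ![a, b, c, d, e]
  rw [toM_mulVec] at h
  simpa [mdiag] using h

theorem r_t1f2 : Reach ∅ ![a, b, c, d, e] ![a - 2 * k * b, b, c, d + k * e, e] :=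
  ((r_s2 a b c d e ∅ (by simp)).trans (r_t12 a d c b e k)).trans (r_s2 _ _ _ _ _ ∅ (by simp))

theorem r_tf12 : Reach ∅ ![a, b, c, d, e] ![a, b + k * a, c, d, e - 2 * k * d] :=
  ((r_s1 a b c d e).trans (r_t12 e b c d a k)).trans (r_s1 _ _ _ _ _)

theorem r_tf1f2 : Reach ∅ ![a, b, c, d, e] ![a, b, c, d + k * a, e - 2 * k * b] :=
  ((r_s1 a b c d e).trans (r_t1f2 e b c d a k)).trans (r_s1 _ _ _ _ _)

theorem r_tf1z : Reach ∅ ![a, b, c, d, e]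
    ![a, b, c + k * a, d, e - 12 * k * c - 6 * k ^ 2 * a] :=
  ((r_s1 a b c d e).trans (r_t1z e b c d a k)).trans (r_s1 _ _ _ _ _)

end rules

/-- Balanced remainder for an odd modulus. -/
theorem red_odd (x a : ℤ) (ha : a % 2 = 1) : ∃ k : ℤ, 2 * |x + k * a| < |a| := by
  have ha0 : a ≠ 0 := by rintro rfl; simp at ha
  have hpos : 0 < |a| := abs_pos.mpr ha0
  have h1 := Int.emod_nonneg x ha0
  have h2 := Int.emod_lt_abs x ha0
  have h3 := Int.emod_add_mul_ediv x a
  by_cases h : 2 * (x % a) < |a|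
  · refine ⟨-(x / a), ?_⟩
    have : x + -(x / a) * a = x % a := by linarith [mul_comm a (x / a)]
    rw [this, abs_of_nonneg h1]
    exact h
  · have hodd : |a| % 2 = 1 := by
      rcases abs_choice a with h | h <;> rw [h] <;> omega
    obtain ⟨s, hs⟩ : ∃ s : ℤ, s * a = -|a| := by
      rcases abs_choice a with h | h
      · exact ⟨-1, by rw [h]; ring⟩
      · exact ⟨1, by rw [h]; ring⟩
    refine ⟨-(x / a) + s, ?_⟩
    have : x + (-(x / a) + s) * a = x % a - |a| := by
      rw [add_mul, hs]; linarith [mul_comm a (x / a)]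
    rw [this, abs_of_neg (by omega)]
    omega

/-- Balanced remainder modulo `2 m`. -/
theorem red_two (x m : ℤ) (hm : m ≠ 0) : ∃ k : ℤ, |x - 2 * k * m| ≤ |m| := by
  have hm2 : 2 * m ≠ 0 := by simpa using hm
  have h1 := Int.emod_nonneg x hm2
  have h2 := Int.emod_lt_abs x hm2
  have h3 := Int.emod_add_mul_ediv x (2 * m)
  rw [abs_mul, abs_two] at h2
  by_cases h : x % (2 * m) ≤ |m|
  · refine ⟨x / (2 * m), ?_⟩
    have : x - 2 * (x / (2 * m)) * m = x % (2 * m) := by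
      linear_combination -h3
    rw [this, abs_of_nonneg h1]
    exact h
  · obtain ⟨s, hs⟩ : ∃ s : ℤ, s * m = |m| := by
      rcases abs_choice m with h | h
      · exact ⟨1, by rw [h]; ring⟩
      · exact ⟨-1, by rw [h]; ring⟩
    refine ⟨x / (2 * m) + s, ?_⟩
    have : x - 2 * (x / (2 * m) + s) * m = x % (2 * m) - 2 * |m| := by
      linear_combination -h3 - 2 * hs
    rw [this, abs_of_neg (by omega)]
    omega

/-- Primitive isotropic vectors. -/
def Good (r : ℤ) (v : Fin 5 → ℤ) : Prop := bf v v = 0 ∧ ∃ u, bf v u = r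

theorem Good.reach {r : ℤ} {S : Set (Fin 5 → ℤ)} {v w : Fin 5 → ℤ} (h : Good r v)
    (hr : Reach S v w) : Good r w := by
  obtain ⟨g, hg, -, rfl⟩ := hr
  obtain ⟨h1, u, h2⟩ := h
  exact ⟨by rw [bf_act (bigG_le hg), h1], act g u, by rw [bf_act (bigG_le hg), h2]⟩

theorem Good.quad {r a b c d e : ℤ} (h : Good r ![a, b, c, d, e]) :
    a * e + 2 * b * d + 6 * c ^ 2 = 0 := by
  have := h.1
  simp [bf] at this
  linarith

theorem Good.lin {r a b c d e : ℤ} (h : Good r ![a, b, c, d, e]) :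
    ∃ u0 u1 u2 u3 u4 : ℤ, a * u4 + 2 * b * u3 + 12 * c * u2 + 2 * d * u1 + e * u0 = r := by
  obtain ⟨u, hu⟩ := h.2
  exact ⟨u 0, u 1, u 2, u 3, u 4, by simpa [bf] using hu⟩

theorem descent (n : ℕ) : ∀ a b c d e : ℤ, a.natAbs = n → a % 2 = 1 → Good 1 ![a, b, c, d, e] →
    Reach ∅ ![a, b, c, d, e] ![1, 0, 0, 0, 0] := by
  induction n using Nat.strong_induction_on with
  | _ n ih =>
  intro a b c d e hn hodd hgood
  have ih' : ∀ a' b' c' d' e' : ℤ, |a'| < |a| → a' % 2 = 1 →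
      Reach ∅ ![a, b, c, d, e] ![a', b', c', d', e'] →
      Reach ∅ ![a, b, c, d, e] ![1, 0, 0, 0, 0] := by
    intro a' b' c' d' e' hlt ho hr
    exact hr.trans (ih a'.natAbs (by rw [← hn]; zify; exact hlt) a' b' c' d' e' rfl ho (hgood.reach hr))
  obtain ⟨b', c', d', e', hr, hb, hc, hd⟩ : ∃ b' c' d' e' : ℤ,
      Reach ∅ ![a, b, c, d, e] ![a, b', c', d', e'] ∧ 2 * |b'| < |a| ∧ 2 * |c'| < |a| ∧
        2 * |d'| < |a| := by
    obtain ⟨k1, h1⟩ := red_odd b a hodd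
    obtain ⟨k2, h2⟩ := red_odd c a hodd
    obtain ⟨k3, h3⟩ := red_odd d a hodd
    exact ⟨_, _, _, _, ((r_tf12 a b c d e k1).trans (r_tf1z _ _ _ _ _ k2)).trans
      (r_tf1f2 _ _ _ _ _ k3), h1, h2, h3⟩
  have hg := hgood.reach hr
  have hq := hg.quad
  -- the step used when the second coordinate is nonzero
  have hstep : ∀ b c d e : ℤ, b ≠ 0 → 2 * |b| < |a| → ∀ {v}, Reach ∅ v ![a, b, c, d, e] →
      ∃ a' d' : ℤ, |a'| < |a| ∧ a' % 2 = 1 ∧ Reach ∅ v ![a', b, c, d', e] := by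
    intro b c d e hb0 hb v hv
    obtain ⟨k, hk⟩ := red_two a b hb0
    refine ⟨a - 2 * k * b, d + k * e, ?_, ?_, hv.trans (r_t1f2 _ _ _ _ _ k)⟩
    · have := abs_pos.mpr hb0
      omega
    · rw [mul_assoc]; omega
  by_cases ha1 : |a| = 1
  · have hb0 : b' = 0 := abs_eq_zero.mp (by have := abs_nonneg b'; omega)
    have hc0 : c' = 0 := abs_eq_zero.mp (by have := abs_nonneg c'; omega)
    have hd0 : d' = 0 := abs_eq_zero.mp (by have := abs_nonneg d'; omega)
    subst hb0 hc0 hd0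
    have ha0 : a ≠ 0 := by rintro rfl; simp at ha1
    have he0 : e' = 0 := by
      have : a * e' = 0 := by linarith
      simpa [ha0] using this
    subst he0
    rcases (abs_eq (by norm_num : (0 : ℤ) ≤ 1)).mp ha1 with h | h
    · rw [h] at hr ⊢; exact hr
    · rw [h] at hr ⊢
      have := hr.trans (r_neg _ _ _ _ _)
      simpa using this
  by_cases hb0 : b' ≠ 0
  · obtain ⟨a2, d2, h1, h2, h3⟩ := hstep b' c' d' e' hb0 hb hr
    exact ih' _ _ _ _ _ h1 h2 h3
  by_cases hd0 : d' ≠ 0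
  · obtain ⟨a2, d2, h1, h2, h3⟩ := hstep d' c' b' e' hd0 hd
      (hr.trans (r_s2 _ _ _ _ _ ∅ (by simp)))
    exact ih' _ _ _ _ _ h1 h2 h3
  push Not at hb0 hd0
  subst hb0 hd0
  have hq' : a * e' = -6 * c' ^ 2 := by linarith
  have ha0 : a ≠ 0 := by rintro rfl; simp at hodd
  by_cases hc0 : c' = 0
  · subst hc0
    have he0 : e' = 0 := by
      have : a * e' = 0 := by linarith
      simpa [ha0] using this
    subst he0
    obtain ⟨u0, u1, u2, u3, u4, hu⟩ := hg.lin
    exfalso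
    apply ha1
    have : a * u4 = 1 := by linarith
    rcases Int.eq_one_or_neg_one_of_mul_eq_one this with h | h <;> simp [h]
  obtain ⟨k, hk⟩ := red_odd (-6 * c') a hodd
  by_cases hb0 : -6 * c' + k * a = 0
  · have hcp := abs_pos.mpr hc0
    have h6 : k * a = 6 * c' := by linarith
    have hk3 : |k| < 3 := by
      have h7 : |k| * |a| = 6 * |c'| := by
        rw [← abs_mul, h6, abs_mul]; norm_num
      by_contra hcon
      push Not at hcon
      nlinarith [abs_nonneg a]
    have hkne : k ≠ 0 := by rintro rfl; simp at h6; exact hc0 h6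
    have hkeven : k % 2 = 0 := by
      have : (k * a) % 2 = 0 := by omega
      rw [Int.mul_emod, hodd] at this
      omega
    have hk2 : k = 2 ∨ k = -2 := by
      rw [abs_lt] at hk3; omega
    have hae : (a = 3 * c' ∧ e' = -2 * c') ∨ (a = -3 * c' ∧ e' = 2 * c') := by
      rcases hk2 with rfl | rfl
      · left
        have h8 : a = 3 * c' := by linarith
        refine ⟨h8, ?_⟩
        apply mul_left_cancel₀ ha0
        rw [hq', h8]; ring
      · right
        have h8 : a = -3 * c' := by linarith
        refine ⟨h8, ?_⟩
        apply mul_left_cancel₀ ha0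
        rw [hq', h8]; ring
    obtain ⟨u0, u1, u2, u3, u4, hu⟩ := hg.lin
    have hc1 : c' = 1 ∨ c' = -1 := by
      rcases hae with ⟨h, h'⟩ | ⟨h, h'⟩
      · apply Int.eq_one_or_neg_one_of_mul_eq_one (v := 3 * u4 + 12 * u2 - 2 * u0)
        rw [← hu, h, h']; ring
      · apply Int.eq_one_or_neg_one_of_mul_eq_one (v := -3 * u4 + 12 * u2 + 2 * u0)
        rw [← hu, h, h']; ring
    have hr2 := (hr.trans (r_t12 _ _ _ _ _ 1)).trans (r_t1f2 _ _ _ _ _ (-1))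
    refine ih' _ _ _ _ _ ?_ ?_ hr2
    · rcases hae with ⟨h, h'⟩ | ⟨h, h'⟩ <;> rcases hc1 with h1 | h1 <;> rw [h, h', h1] <;>
        norm_num
    · rcases hae with ⟨h, h'⟩ | ⟨h, h'⟩ <;> rcases hc1 with h1 | h1 <;> rw [h, h', h1] <;>
        norm_num
  · have hr2 := (hr.trans (r_t2z _ _ _ _ _ 1 ∅ (by simp))).trans (r_tf12 _ _ _ _ _ k)
    have e1 : (0 : ℤ) - 6 * 1 * c' - 3 * 1 ^ 2 * 0 + k * a = -6 * c' + k * a := by ring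
    rw [e1] at hr2
    obtain ⟨a2, d2, h1, h2, h3⟩ := hstep _ _ _ _ hb0 hk hr2
    exact ih' _ _ _ _ _ h1 h2 h3

theorem vec_eta (v : Fin 5 → ℤ) : ∃ a b c d e : ℤ, v = ![a, b, c, d, e] :=
  ⟨v 0, v 1, v 2, v 3, v 4, by ext i; fin_cases i <;> rfl⟩

theorem good_reach (v : Fin 5 → ℤ) (h : Good 1 v) : Reach ∅ v ![1, 0, 0, 0, 0] := by
  obtain ⟨a, b, c, d, e, rfl⟩ := vec_eta v
  by_cases ha : a % 2 = 1
  · exact descent _ a b c d e rfl ha h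
  · have he : e % 2 = 1 := by
      obtain ⟨u0, u1, u2, u3, u4, hu⟩ := h.lin
      by_contra hcon
      obtain ⟨a', rfl⟩ : ∃ a', a = 2 * a' := ⟨a / 2, by omega⟩
      obtain ⟨e', rfl⟩ : ∃ e', e = 2 * e' := ⟨e / 2, by omega⟩
      have : 2 * (a' * u4 + b * u3 + 6 * c * u2 + d * u1 + e' * u0) = 1 := by linarith
      omega
    have hr := r_s1 a b c d e
    exact hr.trans (descent _ e b c d a rfl he (h.reach hr))

/-- The hyperbolic plane that is fixed in the second part of the descent. -/
def hyp : Set (Fin 5 → ℤ) := {![1, 0, 0, 0, 0], ![0, 0, 0, 0, 1]}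

theorem hyp_s2 : ∀ u ∈ hyp, ms2.toM *ᵥ u = u := by
  rintro u (rfl | rfl) <;> rw [toM_mulVec] <;> simp [ms2]

theorem hyp_d2 : ∀ u ∈ hyp, (mdiag 1 (-1) 1 (-1) 1).toM *ᵥ u = u := by
  rintro u (rfl | rfl) <;> rw [toM_mulVec] <;> simp [mdiag]

theorem hyp_t2z : ∀ k, ∀ u ∈ hyp, (m2z k).toM *ᵥ u = u := by
  rintro k u (rfl | rfl) <;> rw [toM_mulVec] <;> simp [m2z]

theorem descent2 (n : ℕ) : ∀ b c d : ℤ, c.natAbs = n → Good 2 ![0, b, c, d, 0] →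
    Reach hyp ![0, b, c, d, 0] ![0, 1, 0, 0, 0] := by
  induction n using Nat.strong_induction_on with
  | _ n ih =>
  intro b c d hn hgood
  have hq := hgood.quad
  have hq' : b * d = -3 * c ^ 2 := by linarith
  -- the case where the last coordinate is small
  have key : ∀ b d : ℤ, Good 2 ![0, b, c, d, 0] → c ≠ 0 → d ≠ 0 → |d| < 2 * |c| →
      Reach hyp ![0, b, c, d, 0] ![0, 1, 0, 0, 0] := by
    intro b d hg hc hd hlt
    obtain ⟨k, hk⟩ : ∃ k : ℤ, |c + k * d| < |c| := by
      rcases le_total 0 c with h1 | h1 <;> rcases le_total 0 d with h2 | h2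
      · refine ⟨-1, ?_⟩
        rw [abs_of_nonneg h1] at *; rw [abs_of_nonneg h2] at hlt; rw [abs_lt]; omega
      · refine ⟨1, ?_⟩
        rw [abs_of_nonneg h1] at *; rw [abs_of_nonpos h2] at hlt; rw [abs_lt]; omega
      · refine ⟨1, ?_⟩
        rw [abs_of_nonpos h1] at *; rw [abs_of_nonneg h2] at hlt; rw [abs_lt]; omega
      · refine ⟨-1, ?_⟩
        rw [abs_of_nonpos h1] at *; rw [abs_of_nonpos h2] at hlt; rw [abs_lt]; omega
    have hr := r_t2z 0 b c d 0 k hyp hyp_t2z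
    exact hr.trans (ih _ (by rw [← hn]; zify; exact hk) _ _ _ rfl (hg.reach hr))
  have hs2 := r_s2 0 b c d 0 hyp hyp_s2
  by_cases hc : c = 0
  · subst hc
    have fin : ∀ b : ℤ, Good 2 ![0, b, 0, 0, 0] → Reach hyp ![0, b, 0, 0, 0] ![0, 1, 0, 0, 0] := by
      intro b hg
      obtain ⟨u0, u1, u2, u3, u4, hu⟩ := hg.lin
      have : b * u3 = 1 := by linarith
      rcases Int.eq_one_or_neg_one_of_mul_eq_one this with h | h
      · rw [h]; exact Reach.refl _ _
      · rw [h]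
        have := r_d2 0 (-1) 0 0 0 hyp hyp_d2
        simpa using this
    have : b * d = 0 := by linarith
    rcases mul_eq_zero.mp this with h | h
    · rw [h] at hs2 hgood ⊢
      exact hs2.trans (fin d (hgood.reach hs2))
    · rw [h] at hgood ⊢
      exact fin b hgood
  · have hc2 : 0 < c ^ 2 := by positivity
    have hbd : b * d ≠ 0 := by rw [hq']; linarith
    have hb : b ≠ 0 := left_ne_zero_of_mul hbd
    have hd : d ≠ 0 := right_ne_zero_of_mul hbd
    by_cases h : |d| < 2 * |c|
    · exact key b d hgood hc hd h
    · have hlt : |b| < 2 * |c| := by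
        by_contra hcon
        push Not at h hcon
        have h9 : |b| * |d| = 3 * |c| ^ 2 := by
          rw [← abs_mul, hq', abs_mul, abs_pow]; norm_num
        have := abs_pos.mpr hc
        nlinarith [mul_le_mul hcon h (by positivity) (by positivity)]
      exact hs2.trans (key d b (hgood.reach hs2) hc hb hlt)

theorem act_gl_eq {g : GL (Fin 5) ℤ} {m : M5} (h : (g : Matrix (Fin 5) (Fin 5) ℤ) = m.toM)
    (v : Fin 5 → ℤ) : act g v = m.toM *ᵥ v := by rw [act, h]

theorem eq_one_of_act {g : GL (Fin 5) ℤ} (h0 : act g ![1, 0, 0, 0, 0] = ![1, 0, 0, 0, 0])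
    (h1 : act g ![0, 1, 0, 0, 0] = ![0, 1, 0, 0, 0])
    (h2 : act g ![0, 0, 1, 0, 0] = ![0, 0, 1, 0, 0])
    (h3 : act g ![0, 0, 0, 1, 0] = ![0, 0, 0, 1, 0])
    (h4 : act g ![0, 0, 0, 0, 1] = ![0, 0, 0, 0, 1]) : g = 1 := by
  ext i j
  have e0 := congrFun h0 i
  have e1 := congrFun h1 i
  have e2 := congrFun h2 i
  have e3 := congrFun h3 i
  have e4 := congrFun h4 i
  simp [act, mulVec, dotProduct, Fin.sum_univ_succ] at e0 e1 e2 e3 e4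
  fin_cases j
  · fin_cases i <;> simpa using e0
  · fin_cases i <;> simpa using e1
  · fin_cases i <;> simpa using e2
  · fin_cases i <;> simpa using e3
  · fin_cases i <;> simpa using e4

theorem orth_stage5 (M : GL (Fin 5) ℤ) (hM : M ∈ orthogonalSubgroup matG)
    (h0 : act M ![1, 0, 0, 0, 0] = ![1, 0, 0, 0, 0])
    (h4 : act M ![0, 0, 0, 0, 1] = ![0, 0, 0, 0, 1])
    (h1 : act M ![0, 1, 0, 0, 0] = ![0, 1, 0, 0, 0])
    (h3 : act M ![0, 0, 0, 1, 0] = ![0, 0, 0, 1, 0]) : M ∈ bigG := by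
  obtain ⟨a, b, c, d, e, hv⟩ := vec_eta (act M ![0, 0, 1, 0, 0])
  have b0 := bf_act hM ![0, 0, 1, 0, 0] ![1, 0, 0, 0, 0]
  have b1 := bf_act hM ![0, 0, 1, 0, 0] ![0, 1, 0, 0, 0]
  have b3 := bf_act hM ![0, 0, 1, 0, 0] ![0, 0, 0, 1, 0]
  have b4 := bf_act hM ![0, 0, 1, 0, 0] ![0, 0, 0, 0, 1]
  have b2 := bf_act hM ![0, 0, 1, 0, 0] ![0, 0, 1, 0, 0]
  rw [h0, hv] at b0
  rw [h1, hv] at b1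
  rw [h3, hv] at b3
  rw [h4, hv] at b4
  rw [hv] at b2
  simp [bf] at b0 b1 b3 b4
  subst b0 b1 b3 b4
  simp [bf] at b2
  have hc : c * c = 1 := by linarith
  rcases Int.eq_one_or_neg_one_of_mul_eq_one hc with rfl | rfl
  · rw [eq_one_of_act h0 h1 hv h3 h4]; exact bigG.one_mem
  · obtain ⟨g, hg, e⟩ := hsz
    have : g * M = 1 := by
      apply eq_one_of_act <;> rw [act_mul]
      · rw [h0, act_gl_eq e, toM_mulVec]; simp [mdiag]
      · rw [h1, act_gl_eq e, toM_mulVec]; simp [mdiag]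
      · rw [hv, act_gl_eq e, toM_mulVec]; simp [mdiag]
      · rw [h3, act_gl_eq e, toM_mulVec]; simp [mdiag]
      · rw [h4, act_gl_eq e, toM_mulVec]; simp [mdiag]
    rw [eq_inv_of_mul_eq_one_right this]
    exact bigG.inv_mem hg

theorem mem_of_mul_mem {g M : GL (Fin 5) ℤ} (hg : g ∈ bigG) (h : g * M ∈ bigG) : M ∈ bigG :=
  (bigG.mul_mem_cancel_left hg).mp h

theorem orth_stage4 (M : GL (Fin 5) ℤ) (hM : M ∈ orthogonalSubgroup matG)
    (h0 : act M ![1, 0, 0, 0, 0] = ![1, 0, 0, 0, 0])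
    (h4 : act M ![0, 0, 0, 0, 1] = ![0, 0, 0, 0, 1])
    (h1 : act M ![0, 1, 0, 0, 0] = ![0, 1, 0, 0, 0]) : M ∈ bigG := by
  obtain ⟨a, b, c, d, e, hv⟩ := vec_eta (act M ![0, 0, 0, 1, 0])
  have b0 := bf_act hM ![0, 0, 0, 1, 0] ![1, 0, 0, 0, 0]
  have b1 := bf_act hM ![0, 0, 0, 1, 0] ![0, 1, 0, 0, 0]
  have b4 := bf_act hM ![0, 0, 0, 1, 0] ![0, 0, 0, 0, 1]
  have b2 := bf_act hM ![0, 0, 0, 1, 0] ![0, 0, 0, 1, 0]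
  rw [h0, hv] at b0
  rw [h1, hv] at b1
  rw [h4, hv] at b4
  rw [hv] at b2
  simp [bf] at b0 b1 b4
  subst b0 b4
  have hd : d = 1 := by linarith
  subst hd
  simp [bf] at b2
  obtain ⟨g, hg, hge⟩ := hm2z (-c)
  have hb : b = -3 * c ^ 2 := by linarith
  apply mem_of_mul_mem hg
  apply orth_stage5 _ (Subgroup.mul_mem _ (bigG_le hg) hM) <;> rw [act_mul]
  · rw [h0, act_gl_eq hge, toM_mulVec]; simp [m2z]
  · rw [h4, act_gl_eq hge, toM_mulVec]; simp [m2z]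
  · rw [h1, act_gl_eq hge, toM_mulVec]; simp [m2z]
  · rw [hv, act_gl_eq hge, toM_mulVec]; simp [m2z, hb]; ring

theorem orth_stage3 (M : GL (Fin 5) ℤ) (hM : M ∈ orthogonalSubgroup matG)
    (h0 : act M ![1, 0, 0, 0, 0] = ![1, 0, 0, 0, 0])
    (h4 : act M ![0, 0, 0, 0, 1] = ![0, 0, 0, 0, 1]) : M ∈ bigG := by
  obtain ⟨a, b, c, d, e, hv⟩ := vec_eta (act M ![0, 1, 0, 0, 0])
  have b0 := bf_act hM ![0, 1, 0, 0, 0] ![1, 0, 0, 0, 0]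
  have b4 := bf_act hM ![0, 1, 0, 0, 0] ![0, 0, 0, 0, 1]
  have b1 := bf_act hM ![0, 1, 0, 0, 0] ![0, 1, 0, 0, 0]
  have b3 := bf_act hM ![0, 1, 0, 0, 0] ![0, 0, 0, 1, 0]
  have hg2 : Good 2 (act M ![0, 1, 0, 0, 0]) :=
    ⟨by rw [b1]; simp [bf], _, by rw [b3]; simp [bf]⟩
  rw [h0, hv] at b0
  rw [h4, hv] at b4
  simp [bf] at b0 b4
  subst b0 b4
  rw [hv] at hg2
  obtain ⟨g, hg, hs, hge⟩ := descent2 _ b c d rfl hg2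
  apply mem_of_mul_mem hg
  apply orth_stage4 _ (Subgroup.mul_mem _ (bigG_le hg) hM) <;> rw [act_mul]
  · rw [h0]; exact hs _ (Or.inl rfl)
  · rw [h4]; exact hs _ (Or.inr rfl)
  · rw [hv, hge]

theorem orth_stage2 (M : GL (Fin 5) ℤ) (hM : M ∈ orthogonalSubgroup matG)
    (h0 : act M ![1, 0, 0, 0, 0] = ![1, 0, 0, 0, 0]) : M ∈ bigG := by
  obtain ⟨a, b, c, d, e, hv⟩ := vec_eta (act M ![0, 0, 0, 0, 1])
  have b0 := bf_act hM ![0, 0, 0, 0, 1] ![1, 0, 0, 0, 0]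
  have b4 := bf_act hM ![0, 0, 0, 0, 1] ![0, 0, 0, 0, 1]
  rw [h0, hv] at b0
  rw [hv] at b4
  simp [bf] at b0
  subst b0
  simp [bf] at b4
  have ha : a = -2 * b * d - 6 * c ^ 2 := by linarith
  obtain ⟨g1, hg1, e1⟩ := hm12 (-b)
  obtain ⟨g2, hg2, e2⟩ := hm12 (-d)
  obtain ⟨s, hs, es⟩ := hms2
  obtain ⟨g3, hg3, e3⟩ := hm1z (-c)
  have hg : s * g2 * s * g1 * g3 ∈ bigG :=
    bigG.mul_mem (bigG.mul_mem (bigG.mul_mem (bigG.mul_mem hs hg2) hs) hg1) hg3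
  apply mem_of_mul_mem hg
  apply orth_stage3 _ (Subgroup.mul_mem _ (bigG_le hg) hM) <;>
    rw [act_mul, act_mul, act_mul, act_mul, act_mul]
  · rw [h0]
    simp only [act_gl_eq e1, act_gl_eq e2, act_gl_eq e3, act_gl_eq es, toM_mulVec]
    simp [m12, m1z, ms2]
  · rw [hv]
    simp only [act_gl_eq e1, act_gl_eq e2, act_gl_eq e3, act_gl_eq es, toM_mulVec]
    simp [m12, m1z, ms2, ha]; ring

theorem orth_le : orthogonalSubgroup matG ≤ bigG := by
  intro M hM
  have hgood : Good 1 (act M ![1, 0, 0, 0, 0]) :=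
    ⟨by rw [bf_act hM]; simp [bf], act M ![0, 0, 0, 0, 1], by rw [bf_act hM]; simp [bf]⟩
  obtain ⟨g, hg, -, hge⟩ := good_reach _ hgood
  apply mem_of_mul_mem hg
  apply orth_stage2 _ (Subgroup.mul_mem _ (bigG_le hg) hM)
  rw [act_mul, hge]

/-! ### Transport to the original basis -/

/-- The change of basis. -/
def matP : Matrix (Fin 5) (Fin 5) ℤ :=
  !![2, 0, -12, 2, -2; -2, -2, 0, 2, 0; -2, -2, 0, -2, 2; 0, 2, 0, -2, 2; 2, 2, -12, 0, -2]

/-- 24 times the inverse of the change of basis. -/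
def matR : Matrix (Fin 5) (Fin 5) ℤ :=
  !![12, -12, 0, 0, -12; -6, 6, -6, 6, 6; -1, -1, -1, -1, -1; 6, 6, -6, 6, -6; 12, 0, 0, 12, -12]

theorem matR_mul_matP : matR * matP = (24 : ℤ) • (1 : Matrix (Fin 5) (Fin 5) ℤ) := by
  decide +kernel

theorem matP_mul_matR : matP * matR = (24 : ℤ) • (1 : Matrix (Fin 5) (Fin 5) ℤ) := by
  decide +kernel

theorem matP_gram : matPᵀ * matQ * matP = (48 : ℤ) • matG := by
  decide +kernel

/-- The inclusion of the integral group in the rational group. -/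
noncomputable def toRat : GL (Fin 5) ℤ →* GL (Fin 5) ℚ :=
  Matrix.GeneralLinearGroup.map (Int.castRingHom ℚ)

theorem toRat_val (M : GL (Fin 5) ℤ) : (toRat M : Matrix (Fin 5) (Fin 5) ℚ) =
    (Int.castRingHom ℚ).mapMatrix (M : Matrix (Fin 5) (Fin 5) ℤ) := rfl

theorem toRat_injective : Function.Injective toRat := by
  intro M N h
  have h' := congrArg (fun g : GL (Fin 5) ℚ => (g : Matrix (Fin 5) (Fin 5) ℚ)) h
  ext i j
  have := congrFun (congrFun h' i) j
  simpa [toRat_val] using this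

theorem mapQ_smul (X Y : Matrix (Fin 5) (Fin 5) ℤ)
    (h : X * Y = (24 : ℤ) • (1 : Matrix (Fin 5) (Fin 5) ℤ)) :
    (Int.castRingHom ℚ).mapMatrix X * (Int.castRingHom ℚ).mapMatrix Y =
      (24 : ℚ) • (1 : Matrix (Fin 5) (Fin 5) ℚ) := by
  rw [← map_mul, h]
  ext i j
  simp only [RingHom.mapMatrix_apply, Matrix.map_apply, Matrix.smul_apply, Matrix.one_apply]
  split_ifs <;> simp

/-- The change of basis as a rational invertible matrix. -/
noncomputable def glP : GL (Fin 5) ℚ where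
  val := (Int.castRingHom ℚ).mapMatrix matP
  inv := (24 : ℚ)⁻¹ • (Int.castRingHom ℚ).mapMatrix matR
  val_inv := by
    rw [Matrix.mul_smul, mapQ_smul _ _ matP_mul_matR, smul_smul]
    norm_num
  inv_val := by
    rw [Matrix.smul_mul, mapQ_smul _ _ matR_mul_matP, smul_smul]
    norm_num

/-- The conjugation into the original basis. -/
noncomputable def conjP : GL (Fin 5) ℤ →* GL (Fin 5) ℚ :=
  (MulAut.conj glP).toMonoidHom.comp toRat

theorem conjP_eq {M N : GL (Fin 5) ℤ} (h : (M : Matrix (Fin 5) (Fin 5) ℤ) * matP = matP * N) :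
    conjP N = toRat M := by
  have : conjP N = glP * toRat N * glP⁻¹ := rfl
  rw [this, mul_inv_eq_iff_eq_mul]
  ext1
  show (Int.castRingHom ℚ).mapMatrix matP *
      (Int.castRingHom ℚ).mapMatrix (N : Matrix (Fin 5) (Fin 5) ℤ) =
    (Int.castRingHom ℚ).mapMatrix (M : Matrix (Fin 5) (Fin 5) ℤ) *
      (Int.castRingHom ℚ).mapMatrix matP
  rw [← map_mul, ← map_mul, h]

/-- Reduction modulo 24. -/
noncomputable def red24 : GL (Fin 5) ℤ →* GL (Fin 5) (ZMod 24) :=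
  Matrix.GeneralLinearGroup.map (Int.castRingHom (ZMod 24))

theorem exists_of_red24 {M : GL (Fin 5) ℤ} (h : red24 M = 1) :
    ∃ X : Matrix (Fin 5) (Fin 5) ℤ, (M : Matrix (Fin 5) (Fin 5) ℤ) = 1 + (24 : ℤ) • X := by
  have h' := congrArg (fun g : GL (Fin 5) (ZMod 24) => (g : Matrix (Fin 5) (Fin 5) (ZMod 24))) h
  have key : ∀ i j, ∃ x : ℤ, (M : Matrix (Fin 5) (Fin 5) ℤ) i j =
      (1 : Matrix (Fin 5) (Fin 5) ℤ) i j + 24 * x := by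
    intro i j
    have e : (((M : Matrix (Fin 5) (Fin 5) ℤ) i j : ℤ) : ZMod 24) =
        (((1 : Matrix (Fin 5) (Fin 5) ℤ) i j : ℤ) : ZMod 24) := by
      have := congrFun (congrFun h' i) j
      have e2 : (((1 : Matrix (Fin 5) (Fin 5) ℤ) i j : ℤ) : ZMod 24) =
          (1 : Matrix (Fin 5) (Fin 5) (ZMod 24)) i j := by
        simp [Matrix.one_apply]
      rw [e2]
      exact this
    rw [eq_comm, ZMod.intCast_eq_intCast_iff_dvd_sub] at e
    obtain ⟨x, hx⟩ := e
    exact ⟨x, by push_cast at hx; linarith⟩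
  choose X hX using key
  exact ⟨Matrix.of X, by ext i j; simp [hX]⟩

theorem map_le_map : (orthogonalSubgroup matQ ⊓ red24.ker).map toRat ≤ bigG.map conjP := by
  rintro _ ⟨M, ⟨hM, hk⟩, rfl⟩
  obtain ⟨X, hX⟩ := exists_of_red24 (MonoidHom.mem_ker.mp hk)
  have hMQ : (M : Matrix (Fin 5) (Fin 5) ℤ)ᵀ * matQ * (M : Matrix (Fin 5) (Fin 5) ℤ) = matQ := hM
  set N : Matrix (Fin 5) (Fin 5) ℤ := 1 + matR * X * matP with hN
  have hPN : (M : Matrix (Fin 5) (Fin 5) ℤ) * matP = matP * N := by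
    rw [hX, hN, mul_add, add_mul, ← mul_assoc, ← mul_assoc, matP_mul_matR]
    simp
  have hdetP : matP.det ≠ 0 := by
    intro h0
    have := congrArg Matrix.det matR_mul_matP
    rw [Matrix.det_mul, h0, Matrix.det_smul] at this
    simp at this
  have hdet : N.det = (M : Matrix (Fin 5) (Fin 5) ℤ).det := by
    have := congrArg Matrix.det hPN
    rw [Matrix.det_mul, Matrix.det_mul, mul_comm] at this
    exact (mul_left_cancel₀ hdetP this).symm
  have hunit : IsUnit N.det := by
    rw [hdet]
    exact (Matrix.isUnit_iff_isUnit_det _).mp M.isUnit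
  let N' : GL (Fin 5) ℤ := Matrix.GeneralLinearGroup.mk'' N hunit
  have hN' : (N' : Matrix (Fin 5) (Fin 5) ℤ) = N := rfl
  refine ⟨N', orth_le ?_, conjP_eq hPN⟩
  show (N' : Matrix (Fin 5) (Fin 5) ℤ)ᵀ * matG * (N' : Matrix (Fin 5) (Fin 5) ℤ) = matG
  rw [hN']
  have h48 : (48 : ℤ) • (Nᵀ * matG * N) = (48 : ℤ) • matG := by
    calc (48 : ℤ) • (Nᵀ * matG * N) = Nᵀ * ((48 : ℤ) • matG) * N := by
          rw [Matrix.mul_smul, Matrix.smul_mul]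
      _ = (matP * N)ᵀ * matQ * (matP * N) := by
          rw [← matP_gram, Matrix.transpose_mul]
          simp only [mul_assoc]
      _ = matPᵀ * ((M : Matrix (Fin 5) (Fin 5) ℤ)ᵀ * matQ * (M : Matrix (Fin 5) (Fin 5) ℤ)) *
          matP := by
          rw [← hPN, Matrix.transpose_mul]
          simp only [mul_assoc]
      _ = (48 : ℤ) • matG := by rw [hMQ, matP_gram]
  ext i j
  have := congrFun (congrFun h48 i) j
  simp only [Matrix.smul_apply, smul_eq_mul] at this
  exact mul_left_cancel₀ (by norm_num) this

theorem matA_orth : matAᵀ * matQ * matA = matQ := by decide +kernel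

theorem matB_orth : matBᵀ * matQ * matB = matQ := by decide +kernel

theorem matA_conj : matA * matP = matP * (ltr 15).toM := by decide +kernel

theorem matB_conj : matB * matP = matP * (ltr 25).toM := by decide +kernel

theorem relIndex_main (A B : GL (Fin 5) ℤ)
    (hA : (A : Matrix (Fin 5) (Fin 5) ℤ) = matA)
    (hB : (B : Matrix (Fin 5) (Fin 5) ℤ) = matB) :
    (Subgroup.closure {A, B}).relIndex (orthogonalSubgroup matQ) ≠ 0 := by
  set Γ := Subgroup.closure {A, B} with hΓ
  have hAm : A ∈ Γ := Subgroup.subset_closure (by simp)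
  have hBm : B ∈ Γ := Subgroup.subset_closure (by simp)
  have h8 : Subgroup.closure (gset 8) ≤ (Γ.map toRat).comap conjP := by
    apply gset8_le
    · exact ⟨A, hAm, (conjP_eq (by rw [hA, gl_val, matA_conj])).symm⟩
    · exact ⟨B, hBm, (conjP_eq (by rw [hB, gl_val, matB_conj])).symm⟩
  have h1 : ((Γ.map toRat).comap conjP).relIndex bigG ≠ 0 :=
    fun h => chain_total (Subgroup.relIndex_eq_zero_of_le_left h8 h)
  rw [Subgroup.relIndex_comap] at h1
  have h2 : (Γ.map toRat).relIndex ((orthogonalSubgroup matQ ⊓ red24.ker).map toRat) ≠ 0 :=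
    fun h => h1 (Subgroup.relIndex_eq_zero_of_le_right map_le_map h)
  rw [Subgroup.relIndex_map_map_of_injective _ _ toRat_injective] at h2
  refine Subgroup.relIndex_ne_zero_trans h2 ?_
  rw [Subgroup.inf_relIndex_left]
  have : Finite (GL (Fin 5) (ZMod 24)) := inferInstance
  have hfin : red24.ker.FiniteIndex := inferInstance
  exact (inferInstance : (red24.ker.subgroupOf (orthogonalSubgroup matQ)).FiniteIndex).index_ne_zero

/-- Case 19 of Theorem 1.2: the hypergeometric group `Γ(f,g)` generated by the companion matrices `A`, `B`
of `f(x) = x^5 - x^4 + x - 1` and `g(x) = x^5 + 2*x^4 + 3*x^3 + 3*x^2 + 2*x + 1`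
is an arithmetic subgroup of `O_Q(ℤ)`: it preserves `Q`, it is contained in `O_Q(ℤ)`,
and it has finite index in `O_Q(ℤ)`. -/
theorem hypergeometric_group_arithmetic
    (A B : GL (Fin 5) ℤ)
    (hA : (A : Matrix (Fin 5) (Fin 5) ℤ) = matA)
    (hB : (B : Matrix (Fin 5) (Fin 5) ℤ) = matB) :
    matAᵀ * matQ * matA = matQ ∧
    matBᵀ * matQ * matB = matQ ∧
    Subgroup.closure {A, B} ≤ orthogonalSubgroup matQ ∧
    ((Subgroup.closure {A, B}).subgroupOf (orthogonalSubgroup matQ)).FiniteIndex := by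
  refine ⟨matA_orth, matB_orth, ?_, ⟨relIndex_main A B hA hB⟩⟩
  rw [Subgroup.closure_le]
  rintro s (rfl | rfl)
  · show _ᵀ * _ * _ = _
    rw [hA]; exact matA_orth
  · show _ᵀ * _ * _ = _
    rw [hB]; exact matB_orth
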